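/- Let X be a Banach two-sided ℍ-module, let D(A) be a right ℍ-submodule of X, and let A : D(A) → X be a closed right linear operator such that ρ_S(A) ∩ ℝ ≠ ∅. Consider the mappings S⁻¹ : ρ_S(A) → Lin^r(X), q ↦ S_q⁻¹(A), and Q : ρ_S(A) → Lin^r(X), q ↦ Q_q(A) (ρ_S(A) is an axially symmetric open subset of ℍ, hence the circularization of an open conjugation-invariant subset of ℂ). Then S⁻¹ is right slice regular, Q = −∂_S S⁻¹ on all of ρ_S(A), and consequently Q is real analytic. -/

import Mathlib

open MulOpposite Filter Topology Classical

noncomputable section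

notation "ℍ" => Quaternion ℝ

/-- A *Banach two-sided `ℍ`-module*: a two-sided `ℍ`-module (left `ℍ`-action, right
`ℍ`-action encoded as a left `ℍᵐᵒᵖ`-action) whose complete norm satisfies
`‖qx‖ = ‖xq‖ = |q|‖x‖`, and where real scalars act the same on both sides. -/
class QuatBimodule (Y : Type*) [NormedAddCommGroup Y]
    [Module ℍ Y] [Module ℍᵐᵒᵖ Y] : Prop where
  smul_op_comm : ∀ (p q : ℍ) (y : Y), p • (op q • y) = op q • (p • y)
  norm_smul_left : ∀ (q : ℍ) (y : Y), ‖q • y‖ = ‖q‖ * ‖y‖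
  norm_smul_right : ∀ (q : ℍ) (y : Y), ‖op q • y‖ = ‖q‖ * ‖y‖
  real_smul_comm : ∀ (r : ℝ) (y : Y), ((r : ℝ) : ℍ) • y = op ((r : ℝ) : ℍ) • y

variable {X : Type*} [NormedAddCommGroup X] [Module ℍ X] [Module ℍᵐᵒᵖ X]

/-- Membership in `Lin^r(X)`: additive, right `ℍ`-linear, with finite operator
norm (i.e. `‖B x‖` is bounded on the closed unit ball). -/
def MemLinR (B : X → X) : Prop :=
  (∀ x y : X, B (x + y) = B x + B y) ∧
  (∀ (q : ℍ) (x : X), B (op q • x) = op q • B x) ∧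
  BddAbove ((fun x : X => ‖B x‖) '' {x : X | ‖x‖ ≤ 1})

/-- The operator norm `‖B‖ = sup {‖B x‖ : ‖x‖ ≤ 1}`. -/
def opNorm (B : X → X) : ℝ :=
  sSup ((fun x : X => ‖B x‖) '' {x : X | ‖x‖ ≤ 1})

/-- A right linear operator `A : D(A) → X`, where `D(A)` is a right `ℍ`-submodule
of `X`.  It is encoded as a function `X → X` together with its domain; only the
values on the domain are relevant. -/
structure RightLinearOp (X : Type*) [NormedAddCommGroup X]
    [Module ℍ X] [Module ℍᵐᵒᵖ X] where
  dom : Set X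
  toFun : X → X
  zero_mem : (0 : X) ∈ dom
  add_mem : ∀ ⦃x⦄, x ∈ dom → ∀ ⦃y⦄, y ∈ dom → x + y ∈ dom
  neg_mem : ∀ ⦃x⦄, x ∈ dom → -x ∈ dom
  smulR_mem : ∀ (q : ℍ) ⦃x⦄, x ∈ dom → op q • x ∈ dom
  map_add' : ∀ ⦃x⦄, x ∈ dom → ∀ ⦃y⦄, y ∈ dom → toFun (x + y) = toFun x + toFun y
  map_smulR' : ∀ (q : ℍ) ⦃x⦄, x ∈ dom → toFun (op q • x) = op q • toFun x

namespace RightLinearOp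

variable (T : RightLinearOp X)

/-- `A` is closed: its graph is closed in `X × X`. -/
def IsClosedOp : Prop := IsClosed {p : X × X | p.1 ∈ T.dom ∧ T.toFun p.1 = p.2}

/-- The domain `D(A²)` of `A²`. -/
def dom2 : Set X := {x | x ∈ T.dom ∧ T.toFun x ∈ T.dom}

/-- The operator `Δ_q(A) = A² − 2 Re(q) A + |q|² Id`, with domain `D(A²)`. -/
def delta (q : ℍ) (x : X) : X :=
  T.toFun (T.toFun x) - ((2 * q.re : ℝ) : ℍ) • T.toFun x + ((‖q‖ ^ 2 : ℝ) : ℍ) • x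

/-- `B` is the inverse of `Δ_q(A) : D(A²) → X`, and `B ∈ Lin^r(X)`. -/
def IsQInv (q : ℍ) (B : X → X) : Prop :=
  MemLinR B ∧ (∀ x : X, B x ∈ T.dom2) ∧ (∀ x : X, T.delta q (B x) = x) ∧
    ∀ x ∈ T.dom2, B (T.delta q x) = x

/-- The S-resolvent set `ρ_S(A)`. -/
def rhoS : Set ℍ := {q | ∃ B : X → X, T.IsQInv q B}

/-- `Q_q(A) = Δ_q(A)⁻¹ ∈ Lin^r(X)`, for `q ∈ ρ_S(A)` (junk value otherwise). -/
def qres (q : ℍ) : X → X :=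
  if h : q ∈ T.rhoS then h.choose else fun _ => 0

/-- The (left) S-resolvent operator `S_q⁻¹(A) = Q_q(A) q̄ − A Q_q(A)`, where the
right scalar multiple of an operator is `(B q̄)(x) = B(q̄ x)`. -/
def sres (q : ℍ) : X → X :=
  fun x => T.qres q (star q • x) - T.toFun (T.qres q x)

/-- The coefficients `B_n`: `B_{2k} = Q_{q0}(A)^k`, `B_{2k+1} = Q_{q0}(A)^k S_{q0}⁻¹(A)`. -/
def Bop (q0 : ℍ) (n : ℕ) : X → X :=
  if n % 2 = 0 then (T.qres q0)^[n / 2] else (T.qres q0)^[n / 2] ∘ T.sres q0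

end RightLinearOp

/-- The quaternionic polynomial `Δ_q(p) = p² − 2 Re(q) p + |q|²`. -/
def deltaPoly (q p : ℍ) : ℍ :=
  p ^ 2 - ((2 * q.re : ℝ) : ℍ) * p + ((‖q‖ ^ 2 : ℝ) : ℍ)

/-- The "powers" `p_{q0,n}`: `p_{q0,2k}(q) = Δ_{q0}(q)^k`,
`p_{q0,2k+1}(q) = (q − q0) Δ_{q0}(q)^k`. -/
def spow (q0 : ℍ) (n : ℕ) (q : ℍ) : ℍ :=
  if n % 2 = 0 then deltaPoly q0 q ^ (n / 2) else (q - q0) * deltaPoly q0 q ^ (n / 2)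

/-- The Cassini pseudo-metric `u(p,q) = √|Δ_q(p)|`. -/
def cassini (p q : ℍ) : ℝ := Real.sqrt ‖deltaPoly q p‖

/-- The Cassini ball `U(q0,R)`. -/
def cassiniBall (q0 : ℍ) (R : ℝ) : Set ℍ := {p : ℍ | cassini p q0 < R}

/-- The Cassini topology on `ℍ`: the topology induced by the Cassini pseudo-metric,
i.e. the topology generated by the Cassini balls. -/
def cassiniTopology : TopologicalSpace ℍ :=
  TopologicalSpace.generateFrom {U : Set ℍ | ∃ q0 R, 0 < R ∧ U = cassiniBall q0 R}

/-- The spherical derivative of a function `g : ℍ → ℍ`. -/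
def sderivQ (g : ℍ → ℍ) (q : ℍ) : ℍ :=
  if q.im = 0 then deriv (fun t : ℝ => g ((t : ℝ) : ℍ)) q.re
  else (g q - g (star q)) * (q - star q)⁻¹

end

noncomputable section

/-- The unit imaginary sphere `S = {j ∈ ℍ : j² = −1}`. -/
def Sph : Set ℍ := {j : ℍ | j * j = -1}

/-- The circularization `Ω_D ⊆ ℍ` of a set `D ⊆ ℂ`. -/
def circ (D : Set ℂ) : Set ℍ :=
  {q : ℍ | ∃ (r s : ℝ) (j : ℍ), j ∈ Sph ∧ (⟨r, s⟩ : ℂ) ∈ D ∧ q = ((r : ℝ) : ℍ) + s • j}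

/-- A function `f : Ω_D → X`, `X` a Banach two-sided `ℍ`-module, is
*right slice regular* if it is induced by a stem function `F = (F₁,F₂) : D → X²`
(`F₁` even, `F₂` odd under complex conjugation) of class `C¹` in the real sense,
i.e. `f(r + s j) = F₁(r + s i) + F₂(r + s i) j` for all `j ∈ S`, satisfying the
Cauchy–Riemann equations `∂F₁/∂r = ∂F₂/∂s`, `∂F₁/∂s = −∂F₂/∂r` on `D`. -/
def RightSliceRegular {X : Type*} [NormedAddCommGroup X] [Module ℍ X]
    [Module ℍᵐᵒᵖ X] [NormedSpace ℝ X] (D : Set ℂ) (f : ℍ → X) : Prop :=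
  ∃ F₁ F₂ : ℂ → X,
    (∀ z ∈ D, F₁ ((starRingEnd ℂ) z) = F₁ z) ∧
    (∀ z ∈ D, F₂ ((starRingEnd ℂ) z) = -F₂ z) ∧
    ContDiffOn ℝ 1 F₁ D ∧ ContDiffOn ℝ 1 F₂ D ∧
    (∀ r s : ℝ, (⟨r, s⟩ : ℂ) ∈ D → ∀ j ∈ Sph,
      f (((r : ℝ) : ℍ) + s • j) = F₁ ⟨r, s⟩ + op j • F₂ ⟨r, s⟩) ∧
    (∀ z ∈ D, fderiv ℝ F₁ z 1 = fderiv ℝ F₂ z Complex.I ∧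
      fderiv ℝ F₁ z Complex.I = -fderiv ℝ F₂ z 1)

/-- The spherical derivative of an `X`-valued function on `ℍ`:
`∂_S f(q) = (f(q) − f(q̄))(q − q̄)⁻¹` off the real axis, and the derivative of `f`
along the real axis at real points. -/
def sderivX {X : Type*} [NormedAddCommGroup X] [Module ℍ X] [Module ℍᵐᵒᵖ X]
    [NormedSpace ℝ X] (f : ℍ → X) (q : ℍ) : X :=
  if q.im = 0 then deriv (fun t : ℝ => f ((t : ℝ) : ℍ)) q.re
  else op ((q - star q)⁻¹) • (f q - f (star q))

/-- `g : Ω → Z`, with `Ω ⊆ ℍ ≅ ℝ⁴` and `Z` a real Banach space, is real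
analytic: around every point of `Ω` it is the sum, in the sense of summability,
of a power series in the four real coordinates with coefficients in `Z`. -/
def RealAnalyticOnH {Z : Type*} [NormedAddCommGroup Z] [NormedSpace ℝ Z]
    (g : ℍ → Z) (Ω : Set ℍ) : Prop :=
  ∀ q0 ∈ Ω, ∃ ε : ℝ, 0 < ε ∧ Metric.ball q0 ε ⊆ Ω ∧
    ∃ c : (Fin 4 → ℕ) → Z, ∀ q ∈ Metric.ball q0 ε,
      HasSum (fun h : Fin 4 → ℕ =>
        (((q.re - q0.re) ^ h 0 * (q.imI - q0.imI) ^ h 1 *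
          (q.imJ - q0.imJ) ^ h 2 * (q.imK - q0.imK) ^ h 3 : ℝ)) • c h) (g q)

end

noncomputable section

/-- Right slice regularity for a function with values in `Lin^r(X)`, realized as
continuous (`ℝ`-linear) operators `X →L[ℝ] X`.  The right multiplication of an
operator `B` by a quaternion `j` is the operator `x ↦ B (j x)`, so the
representation formula `G(r+sj) = F₁(r+si) + F₂(r+si) j` is stated pointwise. -/
def RightSliceRegularCLM {X : Type*} [NormedAddCommGroup X] [Module ℍ X]
    [Module ℍᵐᵒᵖ X] [NormedSpace ℝ X] (D : Set ℂ) (G : ℍ → X →L[ℝ] X) : Prop :=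
  ∃ F₁ F₂ : ℂ → X →L[ℝ] X,
    (∀ z ∈ D, F₁ ((starRingEnd ℂ) z) = F₁ z) ∧
    (∀ z ∈ D, F₂ ((starRingEnd ℂ) z) = -F₂ z) ∧
    ContDiffOn ℝ 1 F₁ D ∧ ContDiffOn ℝ 1 F₂ D ∧
    (∀ r s : ℝ, (⟨r, s⟩ : ℂ) ∈ D → ∀ j ∈ Sph, ∀ x : X,
      G (((r : ℝ) : ℍ) + s • j) x = F₁ ⟨r, s⟩ x + F₂ ⟨r, s⟩ (j • x)) ∧
    (∀ z ∈ D, fderiv ℝ F₁ z 1 = fderiv ℝ F₂ z Complex.I ∧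
      fderiv ℝ F₁ z Complex.I = -fderiv ℝ F₂ z 1)

/-- The quadratic pencil `1 - 2tR + nR²` in a real Banach algebra. -/
def pencil {𝔸 : Type*} [NormedRing 𝔸] [NormedAlgebra ℝ 𝔸] (R : 𝔸) (t n : ℝ) : 𝔸 :=
  1 - (2 * t) • R + n • (R * R)

/-- The even component of the stem function of the S-resolvent, in terms of a real resolvent. -/
def evenStem {𝔸 : Type*} [NormedRing 𝔸] [NormedAlgebra ℝ 𝔸] (R : 𝔸) (t s : ℝ) : 𝔸 :=
  (t • (R * R) - R) * Ring.inverse (pencil R t (t ^ 2 + s ^ 2))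

/-- The odd component of the stem function of the S-resolvent, in terms of a real resolvent. -/
def oddStem {𝔸 : Type*} [NormedRing 𝔸] [NormedAlgebra ℝ 𝔸] (R : 𝔸) (t s : ℝ) : 𝔸 :=
  -(s • (R * R)) * Ring.inverse (pencil R t (t ^ 2 + s ^ 2))

section BanachAlgebra

variable {𝔸 : Type*} [NormedRing 𝔸] [NormedAlgebra ℝ 𝔸]

lemma inverse_pencil_commute (R : 𝔸) (t n : ℝ) :
    Ring.inverse (pencil R t n) * R = R * Ring.inverse (pencil R t n) := by
  by_cases h : IsUnit (pencil R t n)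
  · obtain ⟨u, hu⟩ := h
    rw [← hu, Ring.inverse_unit]
    have : Commute (u : 𝔸) R := by
      rw [hu, pencil]
      exact ((Commute.one_left R).sub_left ((Commute.refl R).smul_left _)).add_left
        (((Commute.refl R).mul_left (Commute.refl R)).smul_left _)
    exact this.units_inv_left
  · simp [Ring.inverse_non_unit _ h]

lemma mul_self_inverse_pencil (R : 𝔸) {t n : ℝ} (h : IsUnit (pencil R t n)) :
    R * R * Ring.inverse (pencil R t n) =
      (R * R - (2 * t) • (R * R * R) + n • (R * R * R * R)) * Ring.inverse (pencil R t n)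
        * Ring.inverse (pencil R t n) := by
  have : R * R - (2 * t) • (R * R * R) + n • (R * R * R * R) = R * R * pencil R t n := by
    simp only [pencil, mul_add, mul_sub, mul_one, mul_smul_comm, mul_assoc]
  rw [this, mul_assoc (R * R), Ring.mul_inverse_cancel _ h, mul_one]

variable [CompleteSpace 𝔸]

lemma HasDerivAt.ringInverse {p : ℝ → 𝔸} {p' : 𝔸} {t : ℝ} (hp : HasDerivAt p p' t)
    (h : IsUnit (p t)) :
    HasDerivAt (fun τ => Ring.inverse (p τ)) (-(Ring.inverse (p t) * p' * Ring.inverse (p t))) t := by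
  obtain ⟨u, hu⟩ := h
  have h1 := hasFDerivAt_ringInverse (𝕜 := ℝ) u
  rw [hu] at h1
  have h2 := h1.comp_hasDerivAt t hp
  rw [← hu, Ring.inverse_unit]
  simpa using! h2

lemma hasDerivAt_evenStem_left (R : 𝔸) {t s : ℝ} (h : IsUnit (pencil R t (t ^ 2 + s ^ 2))) :
    HasDerivAt (fun τ => evenStem R τ s)
      (-(R * R * Ring.inverse (pencil R t (t ^ 2 + s ^ 2))) +
        (2 * s ^ 2) • (R * R * R * R * Ring.inverse (pencil R t (t ^ 2 + s ^ 2)) *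
          Ring.inverse (pencil R t (t ^ 2 + s ^ 2)))) t := by
  have hp : HasDerivAt (fun τ : ℝ => pencil R τ (τ ^ 2 + s ^ 2))
      (-((2 : ℝ) • R) + (2 * t) • (R * R)) t := by
    have h1 : HasDerivAt (fun τ : ℝ => 2 * τ) 2 t := by
      simpa using (hasDerivAt_id t).const_mul (2 : ℝ)
    have h2 : HasDerivAt (fun τ : ℝ => τ ^ 2 + s ^ 2) (2 * t) t := by
      simpa using (hasDerivAt_pow 2 t).add_const (s ^ 2)
    exact (((h1.smul_const R).const_sub 1).add (h2.smul_const (R * R)))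
  have hA : HasDerivAt (fun τ : ℝ => τ • (R * R) - R) (R * R) t := by
    simpa using ((hasDerivAt_id t).smul_const (R * R)).sub_const R
  refine (hA.mul (hp.ringInverse h)).congr_deriv ?_
  have hc := inverse_pencil_commute R t (t ^ 2 + s ^ 2)
  rw [mul_self_inverse_pencil R h]
  set V := Ring.inverse (pencil R t (t ^ 2 + s ^ 2))
  have hc' : ∀ y, V * (R * y) = R * (V * y) := fun y => by rw [← mul_assoc, hc, mul_assoc]
  simp only [mul_add, add_mul, sub_mul, mul_neg, neg_mul, smul_mul_assoc,
    mul_smul_comm, mul_assoc, hc', smul_sub, smul_smul]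
  module

lemma hasDerivAt_oddStem_right (R : 𝔸) {t s : ℝ} (h : IsUnit (pencil R t (t ^ 2 + s ^ 2))) :
    HasDerivAt (fun τ => oddStem R t τ)
      (-(R * R * Ring.inverse (pencil R t (t ^ 2 + s ^ 2))) +
        (2 * s ^ 2) • (R * R * R * R * Ring.inverse (pencil R t (t ^ 2 + s ^ 2)) *
          Ring.inverse (pencil R t (t ^ 2 + s ^ 2)))) s := by
  have hp : HasDerivAt (fun τ : ℝ => pencil R t (t ^ 2 + τ ^ 2)) ((2 * s) • (R * R)) s := by
    have h2 : HasDerivAt (fun τ : ℝ => t ^ 2 + τ ^ 2) (2 * s) s := by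
      simpa using (hasDerivAt_pow 2 s).const_add (t ^ 2)
    exact (h2.smul_const (R * R)).const_add _
  have hA : HasDerivAt (fun τ : ℝ => -(τ • (R * R))) (-(R * R)) s := by
    simpa using! ((hasDerivAt_id s).smul_const (R * R)).neg
  refine (hA.mul (hp.ringInverse h)).congr_deriv ?_
  have hc := inverse_pencil_commute R t (t ^ 2 + s ^ 2)
  set V := Ring.inverse (pencil R t (t ^ 2 + s ^ 2))
  have hc' : ∀ y, V * (R * y) = R * (V * y) := fun y => by rw [← mul_assoc, hc, mul_assoc]
  simp only [mul_neg, neg_mul, smul_mul_assoc, mul_smul_comm, mul_assoc, hc', smul_neg, smul_smul]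
  module

lemma hasDerivAt_evenStem_right (R : 𝔸) {t s : ℝ} (h : IsUnit (pencil R t (t ^ 2 + s ^ 2))) :
    HasDerivAt (fun τ => evenStem R t τ)
      ((2 * s) • ((R * R * R - t • (R * R * R * R)) *
        Ring.inverse (pencil R t (t ^ 2 + s ^ 2)) *
          Ring.inverse (pencil R t (t ^ 2 + s ^ 2)))) s := by
  have hp : HasDerivAt (fun τ : ℝ => pencil R t (t ^ 2 + τ ^ 2)) ((2 * s) • (R * R)) s := by
    have h2 : HasDerivAt (fun τ : ℝ => t ^ 2 + τ ^ 2) (2 * s) s := by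
      simpa using (hasDerivAt_pow 2 s).const_add (t ^ 2)
    exact (h2.smul_const (R * R)).const_add _
  refine ((hp.ringInverse h).const_mul (t • (R * R) - R)).congr_deriv ?_
  have hc := inverse_pencil_commute R t (t ^ 2 + s ^ 2)
  set V := Ring.inverse (pencil R t (t ^ 2 + s ^ 2))
  have hc' : ∀ y, V * (R * y) = R * (V * y) := fun y => by rw [← mul_assoc, hc, mul_assoc]
  simp only [mul_neg, sub_mul, smul_mul_assoc, mul_smul_comm, mul_assoc, hc',
    smul_sub, smul_smul]
  module

lemma hasDerivAt_oddStem_left (R : 𝔸) {t s : ℝ} (h : IsUnit (pencil R t (t ^ 2 + s ^ 2))) :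
    HasDerivAt (fun τ => oddStem R τ s)
      (-((2 * s) • ((R * R * R - t • (R * R * R * R)) *
        Ring.inverse (pencil R t (t ^ 2 + s ^ 2)) *
          Ring.inverse (pencil R t (t ^ 2 + s ^ 2))))) t := by
  have hp : HasDerivAt (fun τ : ℝ => pencil R τ (τ ^ 2 + s ^ 2))
      (-((2 : ℝ) • R) + (2 * t) • (R * R)) t := by
    have h1 : HasDerivAt (fun τ : ℝ => 2 * τ) 2 t := by
      simpa using (hasDerivAt_id t).const_mul (2 : ℝ)
    have h2 : HasDerivAt (fun τ : ℝ => τ ^ 2 + s ^ 2) (2 * t) t := by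
      simpa using (hasDerivAt_pow 2 t).add_const (s ^ 2)
    exact (((h1.smul_const R).const_sub 1).add (h2.smul_const (R * R)))
  refine ((hp.ringInverse h).const_mul (-(s • (R * R)))).congr_deriv ?_
  have hc := inverse_pencil_commute R t (t ^ 2 + s ^ 2)
  set V := Ring.inverse (pencil R t (t ^ 2 + s ^ 2))
  have hc' : ∀ y, V * (R * y) = R * (V * y) := fun y => by rw [← mul_assoc, hc, mul_assoc]
  simp only [mul_add, add_mul, mul_neg, neg_mul, sub_mul, smul_mul_assoc,
    mul_smul_comm, mul_assoc, hc', smul_sub, smul_neg, smul_smul]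
  module

lemma ContDiffAt.pencil_inverse {E : Type*} [NormedAddCommGroup E] [NormedSpace ℝ E] (R : 𝔸)
    {t n : E → ℝ} {z : E} {k : WithTop ℕ∞} (ht : ContDiffAt ℝ k t z) (hn : ContDiffAt ℝ k n z)
    (h : IsUnit (pencil R (t z) (n z))) :
    ContDiffAt ℝ k (fun w => Ring.inverse (pencil R (t w) (n w))) z := by
  have h1 : ContDiffAt ℝ k (fun w => pencil R (t w) (n w)) z := by
    unfold pencil
    fun_prop
  obtain ⟨u, hu⟩ := h
  have h2 := contDiffAt_ringInverse ℝ (n := k) u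
  rw [hu] at h2
  exact h2.comp z h1

lemma contDiffAt_evenStem (R : 𝔸) (r₀ : ℝ) {z : ℂ} {k : WithTop ℕ∞}
    (h : IsUnit (pencil R (z.re - r₀) ((z.re - r₀) ^ 2 + z.im ^ 2))) :
    ContDiffAt ℝ k (fun w : ℂ => evenStem R (w.re - r₀) w.im) z := by
  have hre : ContDiffAt ℝ k (fun w : ℂ => w.re) z := Complex.reCLM.contDiff.contDiffAt
  have him : ContDiffAt ℝ k (fun w : ℂ => w.im) z := Complex.imCLM.contDiff.contDiffAt
  have h1 : ContDiffAt ℝ k (fun w : ℂ => w.re - r₀) z := by fun_prop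
  exact ((h1.smul contDiffAt_const).sub contDiffAt_const).mul
    (ContDiffAt.pencil_inverse R h1 ((h1.pow 2).add (him.pow 2)) h)

lemma contDiffAt_oddStem (R : 𝔸) (r₀ : ℝ) {z : ℂ} {k : WithTop ℕ∞}
    (h : IsUnit (pencil R (z.re - r₀) ((z.re - r₀) ^ 2 + z.im ^ 2))) :
    ContDiffAt ℝ k (fun w : ℂ => oddStem R (w.re - r₀) w.im) z := by
  have hre : ContDiffAt ℝ k (fun w : ℂ => w.re) z := Complex.reCLM.contDiff.contDiffAt
  have him : ContDiffAt ℝ k (fun w : ℂ => w.im) z := Complex.imCLM.contDiff.contDiffAt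
  have h1 : ContDiffAt ℝ k (fun w : ℂ => w.re - r₀) z := by fun_prop
  exact (him.smul contDiffAt_const).neg.mul
    (ContDiffAt.pencil_inverse R h1 ((h1.pow 2).add (him.pow 2)) h)

end BanachAlgebra

section PartialDerivatives

variable {E : Type*} [NormedAddCommGroup E] [NormedSpace ℝ E] {G : ℝ → ℝ → E} {r₀ : ℝ} {z : ℂ}
  {a : E}

lemma fderiv_apply_one_of_hasDerivAt
    (hd : DifferentiableAt ℝ (fun w : ℂ => G (w.re - r₀) w.im) z)
    (h : HasDerivAt (fun τ => G τ z.im) a (z.re - r₀)) :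
    fderiv ℝ (fun w : ℂ => G (w.re - r₀) w.im) z 1 = a := by
  rw [← hd.lineDeriv_eq_fderiv]
  refine HasLineDerivAt.lineDeriv ?_
  have h1 : HasDerivAt (fun τ : ℝ => z.re + τ - r₀) 1 0 :=
    ((hasDerivAt_id (0 : ℝ)).const_add z.re).sub_const r₀
  have h2 : HasDerivAt (fun τ => G τ z.im) a (z.re + 0 - r₀) := by simpa using h
  simpa [HasLineDerivAt, Function.comp_def] using! h2.scomp 0 h1

lemma fderiv_apply_I_of_hasDerivAt
    (hd : DifferentiableAt ℝ (fun w : ℂ => G (w.re - r₀) w.im) z)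
    (h : HasDerivAt (fun τ => G (z.re - r₀) τ) a z.im) :
    fderiv ℝ (fun w : ℂ => G (w.re - r₀) w.im) z Complex.I = a := by
  rw [← hd.lineDeriv_eq_fderiv]
  refine HasLineDerivAt.lineDeriv ?_
  have h1 : HasDerivAt (fun τ : ℝ => z.im + τ) 1 0 :=
    (hasDerivAt_id (0 : ℝ)).const_add z.im
  have h2 : HasDerivAt (fun τ => G (z.re - r₀) τ) a (z.im + 0) := by simpa using h
  simpa [HasLineDerivAt, Function.comp_def] using! h2.scomp 0 h1

end PartialDerivatives

section MultiIndex

variable {ι E Z : Type*} [Fintype ι] [NormedAddCommGroup E] [NormedSpace ℝ E]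
  [NormedAddCommGroup Z] [NormedSpace ℝ Z]

/-- The multi-index counting how often each value is taken by a finite word. -/
def wordContent (k : Σ n : ℕ, (Fin n → ι)) (i : ι) : ℕ :=
  (Finset.univ.filter fun a => k.2 a = i).card

/-- The coefficient of a multi-index monomial in the expansion of a formal multilinear series
along a finite family of vectors. -/
def multiCoeff (p : FormalMultilinearSeries ℝ E Z) (e : ι → E) (h : ι → ℕ) : Z :=
  ∑' k : {k : Σ n : ℕ, (Fin n → ι) // wordContent k = h}, p k.1.1 fun a => e (k.1.2 a)

lemma prod_word (v : ι → ℝ) (k : Σ n : ℕ, (Fin n → ι)) :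
    ∏ a, v (k.2 a) = ∏ i, v i ^ wordContent k i := by
  rw [← Finset.prod_fiberwise' Finset.univ k.2 v]
  simp [wordContent]

lemma HasFPowerSeriesOnBall.hasSum_multiCoeff [CompleteSpace Z] {g : E → Z}
    {p : FormalMultilinearSeries ℝ E Z} {x : E} {r : ENNReal} (hg : HasFPowerSeriesOnBall g p x r)
    {e : ι → E} (he : ∀ i, ‖e i‖ ≤ 1) {M : NNReal} (hM : ((Fintype.card ι * M : NNReal) : ENNReal) < r)
    {v : ι → ℝ} (hv : ∀ i, ‖v i‖ ≤ M) :
    HasSum (fun h : ι → ℕ => (∏ i, v i ^ h i) • multiCoeff p e h) (g (x + ∑ i, v i • e i)) := by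
  set y : E := ∑ i, v i • e i with hy
  have hyn : ‖y‖ ≤ Fintype.card ι * M := by
    calc ‖y‖ ≤ ∑ i, ‖v i • e i‖ := norm_sum_le _ _
      _ ≤ ∑ _i : ι, (M : ℝ) := by
          gcongr with i
          rw [norm_smul]
          calc ‖v i‖ * ‖e i‖ ≤ M * 1 := by
                gcongr
                · exact hv i
                · exact he i
            _ = M := mul_one _
      _ = Fintype.card ι * M := by simp
  have hyb : y ∈ Metric.eball (0 : E) r := by
    rw [mem_eball_zero_iff]
    refine lt_of_le_of_lt ?_ hM
    rw [enorm_eq_nnnorm, ENNReal.coe_le_coe, ← NNReal.coe_le_coe]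
    simpa using hyn
  have hsum := hg.hasSum hyb
  let F : (Σ n : ℕ, (Fin n → ι)) → Z := fun k => (∏ a, v (k.2 a)) • p k.1 fun a => e (k.2 a)
  have hfib : ∀ n, p n (fun _ => y) = ∑ k : Fin n → ι, F ⟨n, k⟩ := by
    intro n
    rw [hy, (p n).map_sum]
    exact Finset.sum_congr rfl fun k _ => (p n).map_smul_univ _ _
  have hbound : ∀ n (k : Fin n → ι), ‖F ⟨n, k⟩‖ ≤ ‖p n‖ * (M : ℝ) ^ n := by
    intro n k
    have h1 : ‖∏ a, v (k a)‖ ≤ (M : ℝ) ^ n := by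
      rw [norm_prod]
      calc ∏ a, ‖v (k a)‖ ≤ ∏ _a : Fin n, (M : ℝ) :=
            Finset.prod_le_prod (fun _ _ => norm_nonneg _) fun a _ => hv (k a)
        _ = (M : ℝ) ^ n := by simp
    have h2 : ‖p n fun a => e (k a)‖ ≤ ‖p n‖ := by
      refine ((p n).le_opNorm _).trans ?_
      refine mul_le_of_le_one_right (norm_nonneg _) ?_
      exact Finset.prod_le_one (fun _ _ => norm_nonneg _) fun a _ => he (k a)
    calc ‖F ⟨n, k⟩‖ = ‖∏ a, v (k a)‖ * ‖p n fun a => e (k a)‖ := norm_smul _ _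
      _ ≤ (M : ℝ) ^ n * ‖p n‖ := by gcongr
      _ = _ := mul_comm _ _
  have hFs : Summable F := by
    refine Summable.of_norm ?_
    rw [summable_sigma_of_nonneg fun _ => norm_nonneg _]
    refine ⟨fun n => Summable.of_finite, ?_⟩
    refine Summable.of_nonneg_of_le (fun n => tsum_nonneg fun _ => norm_nonneg _) (fun n => ?_)
      (p.summable_norm_mul_pow (hM.trans_le hg.r_le))
    rw [tsum_fintype]
    calc ∑ k : Fin n → ι, ‖F ⟨n, k⟩‖ ≤ ∑ _k : Fin n → ι, ‖p n‖ * (M : ℝ) ^ n := by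
          gcongr with k
          exact hbound n k
      _ = ‖p n‖ * ((Fintype.card ι * M : NNReal) : ℝ) ^ n := by
          simp
          ring
  have hF : HasSum F (g (x + y)) := by
    have h1 := hFs.hasSum.sigma fun n => hasSum_fintype fun k : Fin n → ι => F ⟨n, k⟩
    simp only [← hfib] at h1
    rw [← h1.unique hsum]
    exact hFs.hasSum
  have hF' := (Equiv.sigmaFiberEquiv (wordContent (ι := ι))).hasSum_iff.2 hF
  refine hF'.sigma fun h => ?_
  have hs := hF'.summable.sigma_factor h
  convert! hs.hasSum using 1
  rw [multiCoeff, ← tsum_const_smul'']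
  refine tsum_congr fun k => ?_
  change _ = F k.1
  simp only [F, prod_word, k.2]

end MultiIndex

lemma Quaternion.norm_sq_eq_sum (q : ℍ) :
    ‖q‖ ^ 2 = q.re ^ 2 + (q.imI ^ 2 + q.imJ ^ 2 + q.imK ^ 2) := by
  rw [sq, ← Quaternion.normSq_eq_norm_mul_self, Quaternion.normSq_def']
  ring

lemma AnalyticAt.exists_quaternion_hasSum {Z : Type*} [NormedAddCommGroup Z] [NormedSpace ℝ Z]
    [CompleteSpace Z] {g : ℍ → Z} {q₀ : ℍ} (hg : AnalyticAt ℝ g q₀) :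
    ∃ ε : ℝ, 0 < ε ∧ ∃ c : (Fin 4 → ℕ) → Z, ∀ q ∈ Metric.ball q₀ ε,
      HasSum (fun h : Fin 4 → ℕ =>
        (((q.re - q₀.re) ^ h 0 * (q.imI - q₀.imI) ^ h 1 *
          (q.imJ - q₀.imJ) ^ h 2 * (q.imK - q₀.imK) ^ h 3 : ℝ)) • c h) (g q) := by
  obtain ⟨p, r, hp⟩ := hg
  obtain ⟨δ, hδ, hδr⟩ := ENNReal.lt_iff_exists_nnreal_btwn.1 hp.r_pos
  have hδ0 : (0 : ℝ) < δ := by exact_mod_cast hδ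
  let e : Fin 4 → ℍ := ![⟨1, 0, 0, 0⟩, ⟨0, 1, 0, 0⟩, ⟨0, 0, 1, 0⟩, ⟨0, 0, 0, 1⟩]
  have he : ∀ i, ‖e i‖ ≤ 1 := by
    intro i
    refine (sq_le_one_iff₀ (norm_nonneg _)).1 ?_
    rw [Quaternion.norm_sq_eq_sum]
    fin_cases i <;> simp [e]
  refine ⟨δ / 4, by positivity, multiCoeff p e, fun q hq => ?_⟩
  rw [mem_ball_iff_norm] at hq
  let v : Fin 4 → ℝ := ![(q - q₀).re, (q - q₀).imI, (q - q₀).imJ, (q - q₀).imK]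
  have hv : ∀ i, ‖v i‖ ≤ (δ / 4 : NNReal) := by
    intro i
    have h1 : ‖v i‖ ≤ ‖q - q₀‖ := by
      refine (sq_le_sq₀ (norm_nonneg _) (norm_nonneg _)).1 ?_
      rw [Quaternion.norm_sq_eq_sum, Real.norm_eq_abs, sq_abs]
      fin_cases i <;> simp only [v, Fin.isValue, Fin.zero_eta, Fin.mk_one, Fin.reduceFinMk,
        Matrix.cons_val] <;> nlinarith [sq_nonneg (q - q₀).re, sq_nonneg (q - q₀).imI,
          sq_nonneg (q - q₀).imJ, sq_nonneg (q - q₀).imK]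
    push_cast
    linarith
  have hM : ((Fintype.card (Fin 4) * (δ / 4) : NNReal) : ENNReal) < r := by
    have : (Fintype.card (Fin 4) * (δ / 4) : NNReal) = δ := by
      rw [Fintype.card_fin]
      push_cast
      field_simp
    rwa [this]
  have hs := hp.hasSum_multiCoeff he hM hv
  have hq' : q₀ + ∑ i, v i • e i = q := by
    rw [Fin.sum_univ_four]
    ext
    · change q₀.re + ((q.re - q₀.re) * 1 + (q.imI - q₀.imI) * 0 + (q.imJ - q₀.imJ) * 0 + (q.imK - q₀.imK) * 0) = q.re
      ring
    · change q₀.imI + ((q.re - q₀.re) * 0 + (q.imI - q₀.imI) * 1 + (q.imJ - q₀.imJ) * 0 + (q.imK - q₀.imK) * 0) = q.imI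
      ring
    · change q₀.imJ + ((q.re - q₀.re) * 0 + (q.imI - q₀.imI) * 0 + (q.imJ - q₀.imJ) * 1 + (q.imK - q₀.imK) * 0) = q.imJ
      ring
    · change q₀.imK + ((q.re - q₀.re) * 0 + (q.imI - q₀.imI) * 0 + (q.imJ - q₀.imJ) * 0 + (q.imK - q₀.imK) * 1) = q.imK
      ring
  rw [hq'] at hs
  simpa [Fin.prod_univ_four, v] using hs

section ContinuousLinearMap

variable {X : Type*} [NormedAddCommGroup X] [NormedSpace ℝ X] {P : X →L[ℝ] X}

lemma inverse_mul_apply (h : IsUnit P) (x : X) : Ring.inverse P (P x) = x := by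
  rw [← mul_apply_eq_comp, Ring.inverse_mul_cancel _ h, one_apply_eq_self]

lemma mul_inverse_apply (h : IsUnit P) (x : X) : P (Ring.inverse P x) = x := by
  rw [← mul_apply_eq_comp, Ring.mul_inverse_cancel _ h, one_apply_eq_self]

end ContinuousLinearMap

namespace RightLinearOp

variable {X : Type*} [NormedAddCommGroup X] [Module ℍ X] [Module ℍᵐᵒᵖ X] [QuatBimodule X]
  [NormedSpace ℝ X]

/-- `R` is the bounded inverse of `T - r₀`, for a real point `r₀`. -/
structure IsRealResolvent (T : RightLinearOp X) (r₀ : ℝ) (R : X →L[ℝ] X) : Prop where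
  map_smul_op : ∀ (q : ℍ) (x : X), R (op q • x) = op q • R x
  mem_dom : ∀ x, R x ∈ T.dom
  toFun_apply : ∀ x, T.toFun (R x) = x + r₀ • R x
  apply_toFun : ∀ x ∈ T.dom, R (T.toFun x - r₀ • x) = x

/-- The pencil `1 - 2(Re q - r₀)R + |q - r₀|²R²` whose invertibility characterizes the
S-resolvent set. -/
def quatPencil {𝔸 : Type*} [NormedRing 𝔸] [NormedAlgebra ℝ 𝔸] (R : 𝔸) (r₀ : ℝ) (q : ℍ) : 𝔸 :=
  pencil R (q.re - r₀) ((q.re - r₀) ^ 2 + (q.imI ^ 2 + q.imJ ^ 2 + q.imK ^ 2))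

variable (hcompat : ∀ (r : ℝ) (x : X), r • x = ((r : ℝ) : ℍ) • x) (T : RightLinearOp X)

include hcompat

omit [QuatBimodule X] in
lemma delta_eq (q : ℍ) (x : X) : T.delta q x =
    T.toFun (T.toFun x) - (2 * q.re) • T.toFun x + (‖q‖ ^ 2) • x := by
  rw [delta, hcompat, hcompat]

lemma real_smul_eq_op_smul (r : ℝ) (x : X) : r • x = op (r : ℍ) • x := by
  rw [hcompat, QuatBimodule.real_smul_comm]

lemma smul_mem (r : ℝ) {x : X} (hx : x ∈ T.dom) : r • x ∈ T.dom := by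
  rw [real_smul_eq_op_smul hcompat]
  exact T.smulR_mem _ hx

lemma toFun_smul (r : ℝ) {x : X} (hx : x ∈ T.dom) : T.toFun (r • x) = r • T.toFun x := by
  rw [real_smul_eq_op_smul hcompat, real_smul_eq_op_smul hcompat]
  exact T.map_smulR' _ hx

omit hcompat [QuatBimodule X] [NormedSpace ℝ X] in
lemma sub_mem {x y : X} (hx : x ∈ T.dom) (hy : y ∈ T.dom) : x - y ∈ T.dom := by
  rw [sub_eq_add_neg]
  exact T.add_mem hx (T.neg_mem hy)

omit hcompat [QuatBimodule X] [NormedSpace ℝ X] in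
lemma toFun_sub {x y : X} (hx : x ∈ T.dom) (hy : y ∈ T.dom) :
    T.toFun (x - y) = T.toFun x - T.toFun y := by
  rw [eq_sub_iff_add_eq, ← T.map_add' (T.sub_mem hx hy) hy, sub_add_cancel]

omit hcompat [QuatBimodule X] [NormedSpace ℝ X] in
lemma IsQInv.map_zero {T : RightLinearOp X} {q : ℍ} {B : X → X} (hB : T.IsQInv q B) : B 0 = 0 := by
  simpa using hB.1.2.1 0 0

lemma exists_isRealResolvent [CompleteSpace X] {T : RightLinearOp X} (hT : T.IsClosedOp) {r₀ : ℝ}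
    (h : (r₀ : ℍ) ∈ T.rhoS) : ∃ R : X →L[ℝ] X, T.IsRealResolvent r₀ R := by
  obtain ⟨B, hB⟩ := h
  obtain ⟨⟨hadd, hsmul, -⟩, hdom, hright, hleft⟩ := id hB
  have hdelta : ∀ x, T.delta r₀ x = T.toFun (T.toFun x) - (2 * r₀) • T.toFun x + (r₀ ^ 2) • x := by
    intro x
    rw [delta_eq hcompat]
    simp
  let R₀ : X →ₗ[ℝ] X :=
    { toFun := fun x => T.toFun (B x) - r₀ • B x
      map_add' := fun x y => by
        rw [hadd, T.map_add' (hdom x).1 (hdom y).1, smul_add]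
        abel
      map_smul' := fun r x => by
        rw [real_smul_eq_op_smul hcompat r x, hsmul, ← real_smul_eq_op_smul hcompat,
          toFun_smul hcompat T r (hdom x).1, RingHom.id_apply, smul_sub, smul_comm] }
  have hR₀ : ∀ x, R₀ x = T.toFun (B x) - r₀ • B x := fun _ => rfl
  have hmem : ∀ x, R₀ x ∈ T.dom := fun x =>
    T.sub_mem (hdom x).2 (smul_mem hcompat T _ (hdom x).1)
  have hA : ∀ x, T.toFun (R₀ x) = x + r₀ • R₀ x := by
    intro x
    have h1 := hright x
    rw [hdelta] at h1
    rw [hR₀, T.toFun_sub (hdom x).2 (smul_mem hcompat T _ (hdom x).1),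
      toFun_smul hcompat T _ (hdom x).1]
    linear_combination (norm := module) h1
  have hL : ∀ x ∈ T.dom, R₀ (T.toFun x - r₀ • x) = x := by
    intro x hx
    rw [← sub_eq_zero]
    set y := R₀ (T.toFun x - r₀ • x) - x with hy
    have hyd : y ∈ T.dom := T.sub_mem (hmem _) hx
    have hAy : T.toFun y = r₀ • y := by
      rw [hy, T.toFun_sub (hmem _) hx, hA]
      module
    have hy2 : y ∈ T.dom2 := ⟨hyd, by rw [hAy]; exact smul_mem hcompat T _ hyd⟩
    have h1 := hleft y hy2
    rw [hdelta, hAy, toFun_smul hcompat T _ hyd, hAy] at h1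
    rw [← h1, ← hB.map_zero]
    congr 1
    module
  have hclosed : IsClosed (R₀.graph : Set (X × X)) := by
    have h1 : (R₀.graph : Set (X × X)) = (fun p : X × X => (p.2, p.1 + r₀ • p.2)) ⁻¹'
        {p : X × X | p.1 ∈ T.dom ∧ T.toFun p.1 = p.2} := by
      ext ⟨x, y⟩
      simp only [SetLike.mem_coe, LinearMap.mem_graph_iff, Set.mem_preimage, Set.mem_ofPred_eq]
      constructor
      · rintro rfl
        exact ⟨hmem x, hA x⟩
      · rintro ⟨hy, h2⟩
        have h3 := hL y hy
        rw [h2, add_sub_cancel_right] at h3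
        exact h3.symm
    rw [h1]
    exact hT.preimage (by fun_prop)
  refine ⟨ContinuousLinearMap.ofIsClosedGraph hclosed, fun q x => ?_, hmem, hA, hL⟩
  change T.toFun (B (op q • x)) - r₀ • B (op q • x) = op q • (T.toFun (B x) - r₀ • B x)
  rw [hsmul, T.map_smulR' _ (hdom x).1, smul_sub, real_smul_eq_op_smul hcompat,
    real_smul_eq_op_smul hcompat, smul_smul, smul_smul, ← op_mul, ← op_mul,
    Quaternion.coe_commutes]

namespace IsRealResolvent

variable {T} {r₀ : ℝ} {R : X →L[ℝ] X}

omit hcompat [QuatBimodule X] in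
lemma toFun_apply_apply (hR : T.IsRealResolvent r₀ R) (y : X) :
    T.toFun (R (R y)) = R (y + r₀ • R y) := by
  rw [hR.toFun_apply, map_add, map_smul]

omit hcompat [QuatBimodule X] in
lemma apply_apply_mem_dom2 (hR : T.IsRealResolvent r₀ R) (y : X) : R (R y) ∈ T.dom2 :=
  ⟨hR.mem_dom _, by rw [hR.toFun_apply_apply]; exact hR.mem_dom _⟩

lemma exists_apply_apply_eq (hR : T.IsRealResolvent r₀ R) {x : X} (hx : x ∈ T.dom2) :
    ∃ y, R (R y) = x := by
  refine ⟨T.toFun (T.toFun x - r₀ • x) - r₀ • (T.toFun x - r₀ • x), ?_⟩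
  rw [hR.apply_toFun _ (T.sub_mem hx.2 (smul_mem hcompat T r₀ hx.1)), hR.apply_toFun _ hx.1]

omit [QuatBimodule X] in
lemma delta_apply_apply (hR : T.IsRealResolvent r₀ R) (q : ℍ) (y : X) :
    T.delta q (R (R y)) = quatPencil R r₀ q y := by
  rw [delta_eq hcompat, hR.toFun_apply_apply, hR.toFun_apply, Quaternion.norm_sq_eq_sum]
  simp only [quatPencil, pencil, map_add, map_smul, add_apply,
    sub_apply, smul_apply,
    one_apply_eq_self, mul_apply_eq_comp]
  module

lemma isUnit_of_mem_rhoS [CompleteSpace X] (hR : T.IsRealResolvent r₀ R) {q : ℍ}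
    (hq : q ∈ T.rhoS) : IsUnit (quatPencil R r₀ q) := by
  obtain ⟨B, hB⟩ := hq
  rw [ContinuousLinearMap.isUnit_iff_bijective]
  constructor
  · rw [injective_iff_map_eq_zero]
    intro y hy
    have h1 := hB.2.2.2 _ (hR.apply_apply_mem_dom2 y)
    rw [hR.delta_apply_apply hcompat, hy, hB.map_zero] at h1
    have hinj : ∀ w, R w = 0 → w = 0 := fun w hw => by
      have h2 := hR.toFun_apply w
      have h3 := T.map_smulR' 0 T.zero_mem
      rw [hw] at h2
      simp only [op_zero, zero_smul] at h3
      simpa [h3] using h2.symm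
    exact hinj _ (hinj _ h1.symm)
  · intro x
    obtain ⟨y, hy⟩ := hR.exists_apply_apply_eq hcompat (hB.2.1 x)
    exact ⟨y, by rw [← hR.delta_apply_apply hcompat, hy, hB.2.2.1]⟩

lemma isQInv (hR : T.IsRealResolvent r₀ R) {q : ℍ} (h : IsUnit (quatPencil R r₀ q)) :
    T.IsQInv q (R * R * Ring.inverse (quatPencil R r₀ q) : X →L[ℝ] X) := by
  have hsmul : ∀ (p : ℍ) (x : X), quatPencil R r₀ q (op p • x) = op p • quatPencil R r₀ q x := by
    intro p x
    have hc : ∀ (r : ℝ) (y : X), r • op p • y = op p • r • y := fun r y => by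
      rw [hcompat, hcompat, QuatBimodule.smul_op_comm]
    simp [quatPencil, pencil, hR.map_smul_op, hc, smul_add, smul_sub]
  have hinv : ∀ (p : ℍ) (x : X), Ring.inverse (quatPencil R r₀ q) (op p • x) =
      op p • Ring.inverse (quatPencil R r₀ q) x := by
    intro p x
    conv_lhs => rw [← mul_inverse_apply h x, ← hsmul, inverse_mul_apply h]
  refine ⟨⟨map_add _, fun p x => ?_, ?_⟩, fun x => hR.apply_apply_mem_dom2 _, fun x => ?_,
    fun x hx => ?_⟩
  · simp [hinv, hR.map_smul_op]
  · refine ⟨‖R * R * Ring.inverse (quatPencil R r₀ q)‖, ?_⟩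
    rintro _ ⟨x, hx, rfl⟩
    exact ContinuousLinearMap.unit_le_opNorm _ x hx
  · change T.delta q (R (R _)) = x
    rw [hR.delta_apply_apply hcompat]
    exact mul_inverse_apply h x
  · obtain ⟨y, rfl⟩ := hR.exists_apply_apply_eq hcompat hx
    rw [hR.delta_apply_apply hcompat]
    simp [inverse_mul_apply h]

lemma mem_rhoS_iff [CompleteSpace X] (hR : T.IsRealResolvent r₀ R) {q : ℍ} :
    q ∈ T.rhoS ↔ IsUnit (quatPencil R r₀ q) :=
  ⟨hR.isUnit_of_mem_rhoS hcompat, fun h => ⟨_, hR.isQInv hcompat h⟩⟩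

lemma qres_apply [CompleteSpace X] (hR : T.IsRealResolvent r₀ R) {q : ℍ} (hq : q ∈ T.rhoS)
    (x : X) : T.qres q x = (R * R * Ring.inverse (quatPencil R r₀ q)) x := by
  have h := hR.isQInv hcompat ((hR.mem_rhoS_iff hcompat).1 hq)
  have hB : T.IsQInv q (T.qres q) := by
    rw [qres, dif_pos hq]
    exact hq.choose_spec
  have h1 := hB.2.2.2 _ (h.2.1 x)
  rwa [h.2.2.1] at h1

lemma sres_apply [CompleteSpace X] (hR : T.IsRealResolvent r₀ R) {q : ℍ} (hq : q ∈ T.rhoS)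
    (x : X) : T.sres q x = (R * R * Ring.inverse (quatPencil R r₀ q)) (star q • x) -
      (R * Ring.inverse (quatPencil R r₀ q)) x -
        r₀ • (R * R * Ring.inverse (quatPencil R r₀ q)) x := by
  rw [sres, hR.qres_apply hcompat hq, hR.qres_apply hcompat hq]
  simp only [mul_apply_eq_comp, hR.toFun_apply]
  rw [sub_sub]

end IsRealResolvent

end RightLinearOp

lemma re_eq_zero_of_mem_Sph {j : ℍ} (hj : j ∈ Sph) : j.re = 0 := by
  have h : j * j = -1 := hj
  have h0 := congrArg QuaternionAlgebra.re h
  have h1 := congrArg QuaternionAlgebra.imI h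
  have h2 := congrArg QuaternionAlgebra.imJ h
  have h3 := congrArg QuaternionAlgebra.imK h
  simp only [Quaternion.re_mul, Quaternion.imI_mul, Quaternion.imJ_mul, Quaternion.imK_mul,
    Quaternion.re_neg, Quaternion.imI_neg, Quaternion.imJ_neg, Quaternion.imK_neg,
    Quaternion.re_one, Quaternion.imI_one, Quaternion.imJ_one, Quaternion.imK_one] at h0 h1 h2 h3
  by_contra hr
  have e1 : j.imI = 0 := by
    have : j.re * j.imI = 0 := by linarith
    simpa [hr] using this
  have e2 : j.imJ = 0 := by
    have : j.re * j.imJ = 0 := by linarith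
    simpa [hr] using this
  have e3 : j.imK = 0 := by
    have : j.re * j.imK = 0 := by linarith
    simpa [hr] using this
  rw [e1, e2, e3] at h0
  nlinarith [sq_nonneg j.re]

lemma mem_Sph_iff {j : ℍ} :
    j ∈ Sph ↔ j.re = 0 ∧ j.imI ^ 2 + j.imJ ^ 2 + j.imK ^ 2 = 1 := by
  constructor
  · intro hj
    have hr := re_eq_zero_of_mem_Sph hj
    have h0 := congrArg QuaternionAlgebra.re (show j * j = -1 from hj)
    simp only [Quaternion.re_mul, Quaternion.re_neg, Quaternion.re_one, hr] at h0
    exact ⟨hr, by linarith⟩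
  · rintro ⟨hr, h⟩
    change j * j = -1
    ext
    · simp only [Quaternion.re_mul, Quaternion.re_neg, Quaternion.re_one, hr]
      linarith
    · simp [hr, Quaternion.imI_one, mul_comm]
    · simp [hr, Quaternion.imJ_one, mul_comm]
    · simp [hr, Quaternion.imK_one, mul_comm]

lemma star_eq_neg_of_mem_Sph {j : ℍ} (hj : j ∈ Sph) : star j = -j := by
  have := re_eq_zero_of_mem_Sph hj
  ext <;> simp [this]

lemma exists_mem_Sph_eq (q : ℍ) : ∃ s : ℝ, ∃ j ∈ Sph, q = (q.re : ℍ) + s • j := by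
  by_cases h : q.imI ^ 2 + q.imJ ^ 2 + q.imK ^ 2 = 0
  · obtain ⟨j, hj⟩ : ∃ j : ℍ, j ∈ Sph := ⟨⟨0, 1, 0, 0⟩, mem_Sph_iff.2 (by norm_num)⟩
    refine ⟨0, j, hj, ?_⟩
    have h1 : q.imI = 0 := by nlinarith [sq_nonneg q.imI, sq_nonneg q.imJ, sq_nonneg q.imK]
    have h2 : q.imJ = 0 := by nlinarith [sq_nonneg q.imI, sq_nonneg q.imJ, sq_nonneg q.imK]
    have h3 : q.imK = 0 := by nlinarith [sq_nonneg q.imI, sq_nonneg q.imJ, sq_nonneg q.imK]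
    rw [zero_smul]
    ext <;> simp [h1, h2, h3]
  · set n := q.imI ^ 2 + q.imJ ^ 2 + q.imK ^ 2 with hn
    have hpos : 0 < n := lt_of_le_of_ne (by positivity) (Ne.symm h)
    have hs : √n ≠ 0 := (Real.sqrt_pos.2 hpos).ne'
    refine ⟨√n, (√n)⁻¹ • q.im, mem_Sph_iff.2 ⟨by simp, ?_⟩, ?_⟩
    · have h2 : (√n)⁻¹ ^ 2 * n = 1 := by
        rw [inv_pow, Real.sq_sqrt hpos.le, inv_mul_cancel₀ hpos.ne']
      simp only [Quaternion.imI_smul, Quaternion.imJ_smul, Quaternion.imK_smul, Quaternion.imI_im,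
        Quaternion.imJ_im, Quaternion.imK_im, smul_eq_mul]
      linear_combination h2 - (√n)⁻¹ ^ 2 * hn
    · rw [smul_smul, mul_inv_cancel₀ hs, one_smul, Quaternion.re_add_im]

lemma quatPencil_coe_add_smul {𝔸 : Type*} [NormedRing 𝔸] [NormedAlgebra ℝ 𝔸] (R : 𝔸)
    (r₀ r s : ℝ) {j : ℍ} (hj : j ∈ Sph) :
    RightLinearOp.quatPencil R r₀ ((r : ℍ) + s • j) =
      pencil R (r - r₀) ((r - r₀) ^ 2 + s ^ 2) := by
  obtain ⟨h0, h1⟩ := mem_Sph_iff.1 hj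
  have h2 : (s * j.imI) ^ 2 + (s * j.imJ) ^ 2 + (s * j.imK) ^ 2 = s ^ 2 := by
    linear_combination s ^ 2 * h1
  simp [RightLinearOp.quatPencil, h0, h2]

lemma quatPencil_star {𝔸 : Type*} [NormedRing 𝔸] [NormedAlgebra ℝ 𝔸] (R : 𝔸)
    (r₀ : ℝ) (q : ℍ) :
    RightLinearOp.quatPencil R r₀ (star q) = RightLinearOp.quatPencil R r₀ q := by
  simp [RightLinearOp.quatPencil]

lemma analyticAt_quatPencil {𝔸 : Type*} [NormedRing 𝔸] [NormedAlgebra ℝ 𝔸] (R : 𝔸)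
    (r₀ : ℝ) (q : ℍ) : AnalyticAt ℝ (RightLinearOp.quatPencil R r₀) q := by
  have hlin : ∀ f : ℍ →ₗ[ℝ] ℝ, AnalyticAt ℝ f q := fun f =>
    (LinearMap.toContinuousLinearMap f).analyticAt q
  have h0 : AnalyticAt ℝ (fun q : ℍ => q.re) q := hlin (QuaternionAlgebra.reₗ (-1) 0 (-1))
  have h1 : AnalyticAt ℝ (fun q : ℍ => q.imI) q := hlin (QuaternionAlgebra.imIₗ (-1) 0 (-1))
  have h2 : AnalyticAt ℝ (fun q : ℍ => q.imJ) q := hlin (QuaternionAlgebra.imJₗ (-1) 0 (-1))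
  have h3 : AnalyticAt ℝ (fun q : ℍ => q.imK) q := hlin (QuaternionAlgebra.imKₗ (-1) 0 (-1))
  unfold RightLinearOp.quatPencil pencil
  fun_prop

/-- Corollary `Qq analyt`: assume `ρ_S(A) ∩ ℝ ≠ ∅`.  Let
`D ⊆ ℂ` be the conjugation-invariant open set whose circularization is
`ρ_S(A)` (axial symmetry of `ρ_S(A)`), and let `Smap, Qmap : ρ_S(A) → Lin^r(X)`
be the maps `q ↦ S_q⁻¹(A)`, `q ↦ Q_q(A)` (realized as continuous operators
`X →L[ℝ] X`, agreeing pointwise with `S_q⁻¹(A)` resp. `Q_q(A)` on `ρ_S(A)`).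
Then: `circ D = ρ_S(A)`; `S⁻¹` is right slice regular; `Q = −∂_S S⁻¹` on all of
`ρ_S(A)`; and hence `Q` is real analytic. -/
theorem stmt16 {X : Type*} [NormedAddCommGroup X] [CompleteSpace X]
    [Module ℍ X] [Module ℍᵐᵒᵖ X] [QuatBimodule X] [NormedSpace ℝ X]
    (hcompat : ∀ (r : ℝ) (x : X), r • x = ((r : ℝ) : ℍ) • x)
    (T : RightLinearOp X) (hT : T.IsClosedOp)
    (hreal : ∃ r : ℝ, ((r : ℝ) : ℍ) ∈ T.rhoS)
    (D : Set ℂ)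
    (hD : ∀ z : ℂ, z ∈ D ↔ ∃ j ∈ Sph, ((z.re : ℝ) : ℍ) + z.im • j ∈ T.rhoS)
    (Smap Qmap : ℍ → X →L[ℝ] X)
    (hS : ∀ q ∈ T.rhoS, ∀ x : X, Smap q x = T.sres q x)
    (hQ : ∀ q ∈ T.rhoS, ∀ x : X, Qmap q x = T.qres q x) :
    circ D = T.rhoS ∧
    RightSliceRegularCLM D Smap ∧
    (∀ q ∈ T.rhoS,
      (q.im ≠ 0 → ∀ x : X,
        Qmap q x = -(Smap q (((q - star q)⁻¹) • x) -
          Smap (star q) (((q - star q)⁻¹) • x))) ∧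
      (q.im = 0 → Qmap q = -deriv (fun t : ℝ => Smap ((t : ℝ) : ℍ)) q.re)) ∧
    RealAnalyticOnH Qmap T.rhoS := by
  obtain ⟨r₀, hr₀⟩ := hreal
  obtain ⟨R, hR⟩ := RightLinearOp.exists_isRealResolvent hcompat hT hr₀
  have hrho : ∀ q, q ∈ T.rhoS ↔ IsUnit (RightLinearOp.quatPencil R r₀ q) :=
    fun q => hR.mem_rhoS_iff hcompat
  have hslice : ∀ r s : ℝ, ∀ j ∈ Sph, ((r : ℍ) + s • j ∈ T.rhoS ↔
      IsUnit (pencil R (r - r₀) ((r - r₀) ^ 2 + s ^ 2))) := fun r s j hj => by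
    rw [hrho, quatPencil_coe_add_smul R r₀ r s hj]
  have hDunit : ∀ z ∈ D, IsUnit (pencil R (z.re - r₀) ((z.re - r₀) ^ 2 + z.im ^ 2)) := by
    intro z hz
    obtain ⟨j, hj, hzj⟩ := (hD z).1 hz
    exact (hslice _ _ j hj).1 hzj
  have hcirc : circ D = T.rhoS := by
    ext q
    constructor
    · rintro ⟨r, s, j, hj, hz, rfl⟩
      exact (hslice r s j hj).2 (hDunit _ hz)
    · intro hq
      obtain ⟨s, j, hj, hqj⟩ := exists_mem_Sph_eq q
      refine ⟨q.re, s, j, hj, (hD _).2 ⟨j, hj, ?_⟩, hqj⟩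
      change (q.re : ℍ) + s • j ∈ T.rhoS
      rwa [← hqj]
  have hQeq : ∀ q ∈ T.rhoS, Qmap q = R * R * Ring.inverse (RightLinearOp.quatPencil R r₀ q) :=
    fun q hq => ContinuousLinearMap.ext fun x => by rw [hQ q hq, hR.qres_apply hcompat hq]
  have hrep : ∀ r s : ℝ, ∀ j ∈ Sph, (r : ℍ) + s • j ∈ T.rhoS → ∀ x : X,
      Smap ((r : ℍ) + s • j) x = evenStem R (r - r₀) s x + oddStem R (r - r₀) s (j • x) := by
    intro r s j hj hq x
    have hstar : star ((r : ℍ) + s • j) • x = r • x - s • j • x := by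
      rw [hcompat r, hcompat s, smul_smul, ← sub_smul, Quaternion.coe_mul_eq_smul, star_add,
        Quaternion.star_coe, Quaternion.star_smul, star_eq_neg_of_mem_Sph hj, smul_neg,
        sub_eq_add_neg]
    rw [hS _ hq, hR.sres_apply hcompat hq, quatPencil_coe_add_smul R r₀ r s hj, hstar]
    simp only [evenStem, oddStem, mul_apply_eq_comp, sub_apply, smul_apply, neg_apply, map_sub,
      map_smul]
    module
  have hstem1 : ∀ z ∈ D, ∀ k : WithTop ℕ∞,
      ContDiffAt ℝ k (fun w : ℂ => evenStem R (w.re - r₀) w.im) z :=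
    fun z hz k => contDiffAt_evenStem R r₀ (hDunit z hz)
  have hstem2 : ∀ z ∈ D, ∀ k : WithTop ℕ∞,
      ContDiffAt ℝ k (fun w : ℂ => oddStem R (w.re - r₀) w.im) z :=
    fun z hz k => contDiffAt_oddStem R r₀ (hDunit z hz)
  have hnhds : ∀ q ∈ T.rhoS, T.rhoS ∈ 𝓝 q := by
    intro q hq
    filter_upwards [(analyticAt_quatPencil R r₀ q).continuousAt.preimage_mem_nhds
      (Units.isOpen.mem_nhds ((hrho q).1 hq))] with p hp
    exact (hrho p).2 hp
  refine ⟨hcirc, ⟨fun w => evenStem R (w.re - r₀) w.im, fun w => oddStem R (w.re - r₀) w.im,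
    fun z _ => ?_, fun z _ => ?_, fun z hz => (hstem1 z hz 1).contDiffWithinAt,
    fun z hz => (hstem2 z hz 1).contDiffWithinAt, fun r s hz j hj x => ?_, fun z hz => ⟨?_, ?_⟩⟩,
    fun q hq => ⟨fun him x => ?_, fun him => ?_⟩, fun q hq => ?_⟩
  · simp [evenStem]
  · simp [oddStem]
  · exact hrep r s j hj ((hslice r s j hj).2 (hDunit _ hz)) x
  · rw [fderiv_apply_one_of_hasDerivAt ((hstem1 z hz 1).differentiableAt one_ne_zero)
        (hasDerivAt_evenStem_left R (hDunit z hz)),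
      fderiv_apply_I_of_hasDerivAt ((hstem2 z hz 1).differentiableAt one_ne_zero)
        (hasDerivAt_oddStem_right R (hDunit z hz))]
  · rw [fderiv_apply_one_of_hasDerivAt ((hstem2 z hz 1).differentiableAt one_ne_zero)
        (hasDerivAt_oddStem_left R (hDunit z hz)),
      fderiv_apply_I_of_hasDerivAt ((hstem1 z hz 1).differentiableAt one_ne_zero)
        (hasDerivAt_evenStem_right R (hDunit z hz)), neg_neg]
  · have hq' : star q ∈ T.rhoS := by
      rw [hrho, quatPencil_star]
      exact (hrho q).1 hq
    have hne : q - star q ≠ 0 := by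
      intro h
      refine him ?_
      have h1 := Quaternion.star_eq_self.1 (sub_eq_zero.1 h).symm
      rw [h1, Quaternion.im_coe]
    rw [hS q hq, hS _ hq', hR.sres_apply hcompat hq, hR.sres_apply hcompat hq', quatPencil_star,
      star_star, hQeq q hq]
    set B := R * R * Ring.inverse (RightLinearOp.quatPencil R r₀ q)
    set y := (q - star q)⁻¹ • x with hy
    have hx : x = q • y - star q • y := by
      rw [← sub_smul, hy, smul_smul, mul_inv_cancel₀ hne, one_smul]
    rw [hx, map_sub]
    abel
  · have hqr : ((q.re : ℝ) : ℍ) = q := by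
      conv_rhs => rw [← Quaternion.re_add_im q, him, add_zero]
    obtain ⟨-, j, hj, -⟩ := exists_mem_Sph_eq q
    have hreal : ∀ t : ℝ, (t : ℍ) = (t : ℍ) + (0 : ℝ) • j := fun t => by simp
    have hu : IsUnit (pencil R (q.re - r₀) ((q.re - r₀) ^ 2 + 0 ^ 2)) := by
      rw [← hslice q.re 0 j hj, ← hreal, hqr]
      exact hq
    have hev : (fun t : ℝ => Smap (t : ℍ)) =ᶠ[𝓝 q.re] fun t => evenStem R (t - r₀) 0 := by
      have hc : Tendsto (fun t : ℝ => (t : ℍ)) (𝓝 q.re) (𝓝 q) := by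
        have h1 := Quaternion.continuous_coe.tendsto q.re
        rwa [hqr] at h1
      filter_upwards [hc.eventually (hnhds q hq)] with t ht
      ext x
      rw [hreal t] at ht ⊢
      rw [hrep t 0 j hj ht x]
      simp [oddStem]
    have hder := (hasDerivAt_evenStem_left R hu).comp_sub_const q.re r₀
    rw [hev.deriv_eq, hder.deriv, hQeq q hq]
    have hP : RightLinearOp.quatPencil R r₀ q =
        pencil R (q.re - r₀) ((q.re - r₀) ^ 2 + 0 ^ 2) := by
      rw [← quatPencil_coe_add_smul R r₀ q.re 0 hj, ← hreal, hqr]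
    rw [hP]
    simp
  · have han : AnalyticAt ℝ Qmap q := by
      obtain ⟨u, hu⟩ := (hrho q).1 hq
      have h1 := analyticAt_inverse (𝕜 := ℝ) u
      rw [hu] at h1
      have h2 : AnalyticAt ℝ (fun p => R * R * Ring.inverse (RightLinearOp.quatPencil R r₀ p)) q :=
        analyticAt_const.mul (h1.comp (analyticAt_quatPencil R r₀ q))
      refine h2.congr ?_
      filter_upwards [hnhds q hq] with p hp
      exact (hQeq p hp).symm
    obtain ⟨ε, hε, c, hc⟩ := han.exists_quaternion_hasSum
    obtain ⟨δ, hδ, hball⟩ := Metric.mem_nhds_iff.1 (hnhds q hq)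
    exact ⟨min ε δ, lt_min hε hδ, (Metric.ball_subset_ball (min_le_right _ _)).trans hball, c,
      fun p hp => hc p (Metric.ball_subset_ball (min_le_left _ _) hp)⟩

end
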